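/- Let Γ be a discrete abelian group, A, B ⊆ Γ nonempty, and let K ≤ Γ be a finite-index subgroup which is a KJ-stabilizer of A+B. Then for every invariant mean m on ℓ^∞(Γ), m(A) + m(B) − m(A+B) ≤ min{m(A), m(B), [Γ:K]⁻¹}. -/

import Mathlib

open scoped Pointwise
open Filter

namespace SumsetMeans

variable (Γ : Type*) [AddCommGroup Γ] [TopologicalSpace Γ] [DiscreteTopology Γ]

/-- The indicator function of `A ⊆ Γ` as a bounded (continuous, since `Γ` is discrete)
real-valued function, i.e. as an element of `ℓ^∞(Γ)`. -/
noncomputable def ind (A : Set Γ) : BoundedContinuousFunction Γ ℝ :=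
  BoundedContinuousFunction.ofNormedAddCommGroup (Set.indicator A 1)
    continuous_of_discreteTopology 1
    (fun x => by by_cases h : x ∈ A <;> simp [Set.indicator_apply, h])

/-- The translate `τ_γ f`, given by `(τ_γ f)(x) = f (x - γ)`. -/
noncomputable def translate (γ : Γ) (f : BoundedContinuousFunction Γ ℝ) :
    BoundedContinuousFunction Γ ℝ :=
  f.compContinuous ⟨fun x => x - γ, continuous_of_discreteTopology⟩

/-- An invariant mean on `ℓ^∞(Γ)`: a linear functional with `m 1 = 1`, nonnegative on
nonnegative functions, and invariant under all translations. -/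
structure IsInvariantMean (m : BoundedContinuousFunction Γ ℝ →ₗ[ℝ] ℝ) : Prop where
  map_one : m 1 = 1
  nonneg : ∀ f : BoundedContinuousFunction Γ ℝ, (∀ x, 0 ≤ f x) → 0 ≤ m f
  invariant : ∀ (γ : Γ) (f : BoundedContinuousFunction Γ ℝ), m (translate Γ γ f) = m f

/-- The value `m(A) := m(1_A)` of a mean on a set `A ⊆ Γ`. -/
noncomputable def mVal (m : BoundedContinuousFunction Γ ℝ →ₗ[ℝ] ℝ) (A : Set Γ) : ℝ :=
  m (ind Γ A)

/-- Upper Banach density: `d*(A) = sup { m(A) : m an invariant mean on ℓ^∞(Γ) }`. -/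
noncomputable def ubd (A : Set Γ) : ℝ :=
  sSup {x : ℝ | ∃ m, IsInvariantMean Γ m ∧ mVal Γ m A = x}

/-- An extreme invariant mean: an extreme point of the convex set of invariant means. -/
def IsExtremeInvariantMean (ν : BoundedContinuousFunction Γ ℝ →ₗ[ℝ] ℝ) : Prop :=
  ν ∈ Set.extremePoints ℝ {m : BoundedContinuousFunction Γ ℝ →ₗ[ℝ] ℝ | IsInvariantMean Γ m}

/-- `K` is a KJ-stabilizer of `A + B`: a finite-index subgroup such that for every extreme
invariant mean `ν` with `ν(A+B) < ν(A) + ν(B)` one has `ν(A+B) = ν(A+B+K)`, the Kneser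
equation `ν(A+B+K) = ν(A+K) + ν(B+K) - ν(K)`, and `K` is the stabilizer of `A+B+K`. -/
def IsKJStabilizer (A B : Set Γ) (K : AddSubgroup Γ) : Prop :=
  K.FiniteIndex ∧
  ∀ ν : BoundedContinuousFunction Γ ℝ →ₗ[ℝ] ℝ, IsExtremeInvariantMean Γ ν →
    mVal Γ ν (A + B) < mVal Γ ν A + mVal Γ ν B →
      mVal Γ ν (A + B) = mVal Γ ν (A + B + (K : Set Γ)) ∧
      mVal Γ ν (A + B + (K : Set Γ)) =
        mVal Γ ν (A + (K : Set Γ)) + mVal Γ ν (B + (K : Set Γ)) - mVal Γ ν (K : Set Γ) ∧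
      (K : Set Γ) = {γ : Γ | A + B + (K : Set Γ) + {γ} = A + B + (K : Set Γ)}

theorem ind_apply (A : Set Γ) (x : Γ) : ind Γ A x = A.indicator 1 x := rfl

theorem translate_apply (γ : Γ) (f : BoundedContinuousFunction Γ ℝ) (x : Γ) :
    translate Γ γ f x = f (x - γ) := rfl

variable {Γ}

namespace IsInvariantMean

variable {m : BoundedContinuousFunction Γ ℝ →ₗ[ℝ] ℝ}

theorem mono (hm : IsInvariantMean Γ m) {f g : BoundedContinuousFunction Γ ℝ}
    (h : ∀ x, f x ≤ g x) : m f ≤ m g := by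
  have := hm.nonneg (g - f) (fun x => by simpa using h x)
  rw [map_sub] at this
  linarith

theorem mVal_mono (hm : IsInvariantMean Γ m) {A B : Set Γ} (h : A ⊆ B) :
    mVal Γ m A ≤ mVal Γ m B :=
  hm.mono fun x => Set.indicator_le_indicator_of_subset h (fun _ => zero_le_one) x

theorem abs_apply_le_norm (hm : IsInvariantMean Γ m) (f : BoundedContinuousFunction Γ ℝ) :
    |m f| ≤ ‖f‖ := by
  have h1 : m (‖f‖ • 1) = ‖f‖ := by rw [map_smul, hm.map_one]; simp
  have hle : ∀ x, |f x| ≤ ‖f‖ := fun x => f.norm_coe_le_norm x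
  rw [abs_le]
  constructor
  · rw [← h1, ← map_neg]
    exact hm.mono fun x => by simpa using (abs_le.1 (hle x)).1
  · conv_rhs => rw [← h1]
    exact hm.mono fun x => by simpa using (abs_le.1 (hle x)).2

theorem le_mVal_add_left (hm : IsInvariantMean Γ m) {A : Set Γ} (hA : A.Nonempty) (B : Set Γ) :
    mVal Γ m B ≤ mVal Γ m (A + B) := by
  obtain ⟨a, ha⟩ := hA
  rw [mVal, mVal, ← hm.invariant a (ind Γ B)]
  refine hm.mono fun x => ?_
  rw [translate_apply, ind_apply, ind_apply]
  by_cases hx : x - a ∈ B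
  · have : x ∈ A + B := ⟨a, ha, x - a, hx, by simp⟩
    simp [hx, this]
  · rw [Set.indicator_of_notMem hx]
    exact Set.indicator_nonneg (fun _ _ => zero_le_one) x

theorem mVal_subgroup_le (hm : IsInvariantMean Γ m) (K : AddSubgroup Γ) [K.FiniteIndex] :
    mVal Γ m (K : Set Γ) ≤ (K.index : ℝ)⁻¹ := by
  classical
  have := Fintype.ofFinite (Γ ⧸ K)
  have key : ∑ q : Γ ⧸ K, translate Γ q.out (ind Γ (K : Set Γ)) = 1 := by
    ext x
    rw [BoundedContinuousFunction.coe_sum, Finset.sum_apply,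
      Finset.sum_eq_single (x : Γ ⧸ K)]
    · have : x - (x : Γ ⧸ K).out ∈ (K : Set Γ) := by
        rw [SetLike.mem_coe, ← QuotientAddGroup.eq_iff_sub_mem, QuotientAddGroup.out_eq']
      simp [translate_apply, ind_apply, this]
    · intro q _ hq
      rw [translate_apply, ind_apply, Set.indicator_of_notMem]
      rw [SetLike.mem_coe, ← QuotientAddGroup.eq_iff_sub_mem, QuotientAddGroup.out_eq']
      exact fun h => hq h.symm
    · simp
  have hsum := congrArg m key
  simp only [map_sum, hm.invariant, hm.map_one, Finset.sum_const, Finset.card_univ,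
    nsmul_eq_mul] at hsum
  rw [← Nat.card_eq_fintype_card, ← AddSubgroup.index_eq_card] at hsum
  exact (eq_inv_of_mul_eq_one_right hsum).le

end IsInvariantMean

variable (Γ) in
theorem isCompact_coe_isInvariantMean :
    IsCompact ((fun m : BoundedContinuousFunction Γ ℝ →ₗ[ℝ] ℝ =>
      (m : BoundedContinuousFunction Γ ℝ → ℝ)) '' {m | IsInvariantMean Γ m}) := by
  refine (isCompact_univ_pi fun f : BoundedContinuousFunction Γ ℝ =>
    isCompact_Icc (a := -‖f‖) (b := ‖f‖)).of_isClosed_subset ?_ ?_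
  · have heq : (fun m : BoundedContinuousFunction Γ ℝ →ₗ[ℝ] ℝ =>
        (m : BoundedContinuousFunction Γ ℝ → ℝ)) '' {m | IsInvariantMean Γ m} =
        Set.range (fun m : BoundedContinuousFunction Γ ℝ →ₗ[ℝ] ℝ =>
          (m : BoundedContinuousFunction Γ ℝ → ℝ)) ∩ ({φ | φ 1 = 1} ∩
          ({φ | ∀ f : BoundedContinuousFunction Γ ℝ, (∀ x, 0 ≤ f x) → 0 ≤ φ f} ∩
          {φ | ∀ (γ : Γ) (f : BoundedContinuousFunction Γ ℝ),
            φ (translate Γ γ f) = φ f})) := by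
      ext φ
      constructor
      · rintro ⟨m, hm, rfl⟩
        exact ⟨⟨m, rfl⟩, hm.map_one, hm.nonneg, hm.invariant⟩
      · rintro ⟨⟨m, rfl⟩, h1, h2, h3⟩
        exact ⟨m, ⟨h1, h2, h3⟩, rfl⟩
    rw [heq]
    refine (LinearMap.isClosed_range_coe _ _ _).inter (.inter ?_ (.inter ?_ ?_))
    · exact isClosed_eq (continuous_apply _) continuous_const
    · simp only [Set.ofPred_forall]
      exact isClosed_iInter fun f => isClosed_iInter fun _ =>
        isClosed_le continuous_const (continuous_apply _)
    · simp only [Set.ofPred_forall]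
      exact isClosed_iInter fun γ => isClosed_iInter fun f =>
        isClosed_eq (continuous_apply _) (continuous_apply _)
  · rintro _ ⟨m, hm, rfl⟩ f -
    exact abs_le.1 (hm.abs_apply_le_norm f)

/-- Bauer's maximum principle: evaluation at a bounded function is maximized over the
invariant means at an extreme invariant mean. -/
theorem IsInvariantMean.exists_extreme_ge {m : BoundedContinuousFunction Γ ℝ →ₗ[ℝ] ℝ}
    (hm : IsInvariantMean Γ m) (f : BoundedContinuousFunction Γ ℝ) :
    ∃ ν, IsExtremeInvariantMean Γ ν ∧ m f ≤ ν f := by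
  let S := (fun m : BoundedContinuousFunction Γ ℝ →ₗ[ℝ] ℝ =>
      (m : BoundedContinuousFunction Γ ℝ → ℝ)) '' {m | IsInvariantMean Γ m}
  have hSc : IsCompact S := isCompact_coe_isInvariantMean Γ
  let l : StrongDual ℝ (BoundedContinuousFunction Γ ℝ → ℝ) := ContinuousLinearMap.proj f
  obtain ⟨φ, hφS, hφ⟩ := hSc.exists_isMaxOn ⟨m, m, hm, rfl⟩ l.continuous.continuousOn
  have hexp : IsExposed ℝ S (l.toExposed S) := ContinuousLinearMap.toExposed.isExposed
  obtain ⟨ψ, hψ⟩ := (hexp.isCompact hSc).extremePoints_nonempty ⟨φ, hφS, hφ⟩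
  have hmax := hψ.1.2
  obtain ⟨⟨ν, hν, rfl⟩, hext⟩ := hexp.isExtreme.extremePoints_subset_extremePoints hψ
  refine ⟨ν, ⟨hν, ?_⟩, hmax _ ⟨m, hm, rfl⟩⟩
  rintro m₁ h₁ m₂ h₂ ⟨a, b, ha, hb, hab, hseg⟩
  refine DFunLike.coe_injective (hext ⟨m₁, h₁, rfl⟩ ⟨m₂, h₂, rfl⟩ ⟨a, b, ha, hb, hab, ?_⟩)
  rw [← hseg]
  rfl

variable (Γ)

theorem gap_le_min (A B : Set Γ) (hA : A.Nonempty) (hB : B.Nonempty)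
    (K : AddSubgroup Γ) (hK : IsKJStabilizer Γ A B K)
    (m : BoundedContinuousFunction Γ ℝ →ₗ[ℝ] ℝ) (hm : IsInvariantMean Γ m) :
    mVal Γ m A + mVal Γ m B - mVal Γ m (A + B) ≤
      min (mVal Γ m A) (min (mVal Γ m B) ((K.index : ℝ)⁻¹)) := by
  obtain ⟨hfin, hK⟩ := hK
  refine le_min ?_ (le_min ?_ ?_)
  · linarith [hm.le_mVal_add_left hA B]
  · have := hm.le_mVal_add_left hB A
    rw [add_comm B A] at this
    linarith
  · obtain ⟨ν, hν, hle⟩ := hm.exists_extreme_ge (ind Γ A + ind Γ B - ind Γ (A + B))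
    simp only [map_add, map_sub] at hle
    change mVal Γ m A + mVal Γ m B - mVal Γ m (A + B) ≤
      mVal Γ ν A + mVal Γ ν B - mVal Γ ν (A + B) at hle
    refine hle.trans ?_
    have hνm : IsInvariantMean Γ ν := hν.1
    rcases lt_or_ge (mVal Γ ν (A + B)) (mVal Γ ν A + mVal Γ ν B) with h | h
    · obtain ⟨h1, h2, -⟩ := hK ν hν h
      have hsub : ∀ C : Set Γ, C ⊆ C + (K : Set Γ) := fun C =>
        Set.subset_add_left C K.zero_mem
      linarith [hνm.mVal_mono (hsub A), hνm.mVal_mono (hsub B), hνm.mVal_subgroup_le K]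
    · exact (sub_nonpos.2 h).trans (by positivity)

end SumsetMeans
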